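/- Let w ∈ S^(n), 1 ≤ i ≤ n, d ≥ 0, and let ζ = t_{p₁q₁}⋯t_{p_dq_d} be an element of X_{i,d}(w) or of Y_{i,d}(w). Then for every j with q_j > n one has m_{p_jq_j}(w_j) = 0, where w_j = w t_{p₁q₁}⋯t_{p_{j−1}q_{j−1}}. -/

import Mathlib

open scoped Classical

noncomputable section

/-- Permutations of the positive integers. -/
abbrev PPerm := Equiv.Perm ℕ+

/-- A permutation fixes all but finitely many points. -/
def HasFinSupp (w : PPerm) : Prop := {k : ℕ+ | w k ≠ k}.Finite

/-- The transposition `t_{pq}`. -/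
def tr (p q : ℕ+) : PPerm := Equiv.swap p q

/-- The set of inversions `I(w)`. -/
def invSet (w : PPerm) : Set (ℕ+ × ℕ+) := {x | x.1 < x.2 ∧ w x.2 < w x.1}

/-- The length `ℓ(w)` (number of inversions). -/
def len (w : PPerm) : ℕ := (invSet w).ncard

/-- `m_{pq}(z) = #{r > q : z(p) < z(r) < z(q)}`. -/
def mCnt (z : PPerm) (p q : ℕ+) : ℕ := {r : ℕ+ | q < r ∧ z p < z r ∧ z r < z q}.ncard

/-- `m'_{qp}(z) = #{r < p : z(p) < z(r) < z(q)}`. -/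
def m'Cnt (z : PPerm) (q p : ℕ+) : ℕ := {r : ℕ+ | r < p ∧ z p < z r ∧ z r < z q}.ncard

/-- The list of transpositions `t_{p₁q₁}, …, t_{p_dq_d}`. -/
def trList (d : ℕ) (p q : Fin d → ℕ+) : List PPerm := List.ofFn fun j => tr (p j) (q j)

/-- `w_{j+1} = w t_{p₁q₁} ⋯ t_{p_jq_j}` (so `wSeq w d p q 0 = w₁ = w`). -/
def wSeq (w : PPerm) (d : ℕ) (p q : Fin d → ℕ+) (j : ℕ) : PPerm :=
  w * ((trList d p q).take j).prod

/-- The defining conditions on a factorization for membership in `X_{i,d}(w)`. -/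
def IsXFact (w : PPerm) (i d : ℕ) (p q : Fin d → ℕ+) : Prop :=
  (∀ j, (p j : ℕ) ≤ i ∧ i < (q j : ℕ)) ∧
  (∀ j : Fin d, len (wSeq w d p q (j + 1)) = len (wSeq w d p q j) + 1) ∧
  (∀ j k : Fin d, j < k → wSeq w d p q j (p j) < wSeq w d p q k (p k))

/-- The defining conditions on a factorization for membership in `Y_{i,d}(w)`. -/
def IsYFact (w : PPerm) (i d : ℕ) (p q : Fin d → ℕ+) : Prop :=
  (∀ j, (p j : ℕ) ≤ i ∧ i < (q j : ℕ)) ∧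
  (∀ j : Fin d, len (wSeq w d p q (j + 1)) = len (wSeq w d p q j) + 1) ∧
  (∀ j k : Fin d, j < k → wSeq w d p q k (q k) < wSeq w d p q j (q j))

/-- The set `X_{i,d}(w)`. -/
def XSet (w : PPerm) (i d : ℕ) : Set PPerm :=
  {ζ | ∃ p q : Fin d → ℕ+, ζ = (trList d p q).prod ∧ IsXFact w i d p q}

/-- The set `Y_{i,d}(w)`. -/
def YSet (w : PPerm) (i d : ℕ) : Set PPerm :=
  {ζ | ∃ p q : Fin d → ℕ+, ζ = (trList d p q).prod ∧ IsYFact w i d p q}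

/-- `w ∈ S^{(n)}`, i.e. `w(n+1) < w(n+2) < ⋯`. -/
def InSn (n : ℕ) (w : PPerm) : Prop := ∀ k l : ℕ+, (n : ℕ) < (k : ℕ) → k < l → w k < w l

/-- `x₁^{m-1} x₂^{m-2} ⋯ x_{m-1}`, the Schubert polynomial of the longest element of `S_m`. -/
def schubBase (m : ℕ) : MvPolynomial ℕ+ ℤ :=
  ∏ k ∈ Finset.range m, MvPolynomial.X (k.succPNat) ^ (m - 1 - k)

/-- The defining property of the family of Schubert polynomials `w ↦ 𝔖_w`:
the value on dominant "staircase" permutations, together with the divided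
difference recursion `𝔖_{w s_i} = ∂_i 𝔖_w` whenever `ℓ(w s_i) < ℓ(w)`, stated
in the product form `(x_i - x_{i+1}) · 𝔖_{w s_i} = 𝔖_w - s_i 𝔖_w`. -/
def IsSchubertFamily (S : PPerm → MvPolynomial ℕ+ ℤ) : Prop :=
  (∀ m : ℕ, ∀ w : PPerm, (∀ k : ℕ+, (k : ℕ) ≤ m → (w k : ℕ) = m + 1 - (k : ℕ)) →
      (∀ k : ℕ+, m < (k : ℕ) → w k = k) → S w = schubBase m) ∧
  (∀ w : PPerm, ∀ i : ℕ+, len (w * tr i (i + 1)) < len w →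
      (MvPolynomial.X i - MvPolynomial.X (i + 1)) * S (w * tr i (i + 1)) =
        S w - MvPolynomial.rename (Equiv.swap i (i + 1)) (S w))

/-- The complete homogeneous symmetric polynomial `h_d(x₁, …, x_i)`. -/
def hPoly (i d : ℕ) : MvPolynomial ℕ+ ℤ :=
  ∑ m : Sym (Fin i) d, ((m : Multiset (Fin i)).map fun k => MvPolynomial.X (k.val.succPNat)).prod

/-- The elementary symmetric polynomial `e_d(x₁, …, x_i)`. -/
def ePoly (i d : ℕ) : MvPolynomial ℕ+ ℤ :=
  ∑ s ∈ Finset.powersetCard d (Finset.univ : Finset (Fin i)),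
    ∏ k ∈ s, MvPolynomial.X (k.val.succPNat)

/-- Lexicographic order on permutations. -/
def lexLT (u v : PPerm) : Prop := ∃ k : ℕ+, (∀ l, l < k → u l = v l) ∧ u k < v k

/-- Reverse lexicographic order on permutations. -/
def rlexLT (u v : PPerm) : Prop := ∃ k : ℕ+, (∀ l, k < l → u l = v l) ∧ u k < v k


theorem tr_mul_tr (p q : ℕ+) : tr p q * tr p q = 1 := Equiv.swap_mul_self p q

theorem HasFinSupp.mul_tr {w : PPerm} (hw : HasFinSupp w) (p q : ℕ+) :
    HasFinSupp (w * tr p q) := by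
  refine (hw.union (Set.toFinite {p, q})).subset fun k hk => ?_
  by_contra hc
  simp only [Set.mem_union, Set.mem_insert_iff, Set.mem_singleton_iff, not_or] at hc
  apply hk
  rw [Equiv.Perm.mul_apply, tr, Equiv.swap_apply_of_ne_of_ne hc.2.1 hc.2.2]
  simpa using hc.1

theorem HasFinSupp.finite_invSet {w : PPerm} (hw : HasFinSupp w) : (invSet w).Finite := by
  obtain ⟨N, hN⟩ := hw.bddAbove
  have fix : ∀ k, N < k → w k = k := fun k hk => by
    by_contra hc
    exact absurd (hN hc) (not_le.2 hk)
  have le : ∀ k, k ≤ N → w k ≤ N := fun k hk => by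
    by_contra! hc
    have := w.injective (fix _ hc)
    exact absurd hk (not_le.2 (this ▸ hc))
  refine ((Set.finite_Iic N).prod (Set.finite_Iic N)).subset ?_
  rintro ⟨a, b⟩ ⟨hab, hba⟩
  simp only at hab hba
  have hb : b ≤ N := by
    by_contra! hb
    rw [fix b hb] at hba
    rcases le_or_gt a N with ha | ha
    · exact absurd (hba.trans_le (le a ha)) (not_lt.2 hb.le)
    · rw [fix a ha] at hba
      exact absurd hab (not_lt.2 hba.le)
  exact ⟨hab.le.trans hb, hb⟩

/-- The inversions of `w` inject into those of `w t_{pq}` when `w p < w q`. -/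
def invMap (p q : ℕ+) (x : ℕ+ × ℕ+) : ℕ+ × ℕ+ :=
  if tr p q x.1 < tr p q x.2 then (tr p q x.1, tr p q x.2) else x

theorem invMap_injOn (p q : ℕ+) (w : PPerm) : Set.InjOn (invMap p q) (invSet w) := by
  rintro ⟨a, b⟩ ⟨hab, -⟩ ⟨c, d⟩ ⟨hcd, -⟩ h
  have inv : ∀ x, tr p q (tr p q x) = x := Equiv.swap_apply_self p q
  simp only [invMap] at h hab hcd
  split_ifs at h with h1 h2 h2 <;> simp only [Prod.mk.injEq] at h ⊢
  · exact ⟨(tr p q).injective h.1, (tr p q).injective h.2⟩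
  · rw [← h.1, ← h.2, inv, inv] at h2
    exact absurd hab h2
  · rw [h.1, h.2, inv, inv] at h1
    exact absurd hcd h1
  · exact h

theorem mapsTo_invMap {p q : ℕ+} {w : PPerm} (hpq : p < q) (hw : w p < w q) :
    Set.MapsTo (invMap p q) (invSet w) (invSet (w * tr p q)) := by
  rintro ⟨a, b⟩ ⟨hab, hba⟩
  simp only at hab hba
  have inv : ∀ x, tr p q (tr p q x) = x := Equiv.swap_apply_self p q
  unfold invMap
  split_ifs with h
  · exact ⟨h, by simpa [Equiv.Perm.mul_apply, inv] using hba⟩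
  · refine ⟨hab, ?_⟩
    simp only [Equiv.Perm.mul_apply, tr, Equiv.swap_apply_def] at h ⊢
    grind

theorem len_add_ncard_le {p q : ℕ+} {w : PPerm} (hf : HasFinSupp w) (hpq : p < q)
    (hw : w p < w q) (S : Set (ℕ+ × ℕ+)) (hS : S ⊆ invSet (w * tr p q))
    (hd : ∀ x ∈ invSet w, invMap p q x ∉ S) : len w + S.ncard ≤ len (w * tr p q) := by
  have hfin := (hf.mul_tr p q).finite_invSet
  unfold len
  rw [← (invMap_injOn p q w).ncard_image,
    ← Set.ncard_union_eq _ (hf.finite_invSet.image _) (hfin.subset hS)]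
  · exact Set.ncard_le_ncard (Set.union_subset (mapsTo_invMap hpq hw).image_subset hS) hfin
  · rw [Set.disjoint_left]
    rintro _ ⟨x, hx, rfl⟩
    exact hd x hx

theorem len_lt_len_mul_tr {p q : ℕ+} {w : PPerm} (hf : HasFinSupp w) (hpq : p < q)
    (hw : w p < w q) : len w < len (w * tr p q) := by
  have := len_add_ncard_le hf hpq hw {(p, q)} (by
    rintro _ rfl
    exact ⟨hpq, by simpa [tr] using hw⟩) (by
    rintro ⟨a, b⟩ ⟨hab, hba⟩ h
    simp only [invMap, tr, Equiv.swap_apply_def, Set.mem_singleton_iff] at h hab hba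
    grind)
  rw [Set.ncard_singleton] at this
  omega

theorem apply_lt_of_len_mul_tr {p q : ℕ+} {w : PPerm} (hf : HasFinSupp w) (hpq : p < q)
    (h : len (w * tr p q) = len w + 1) : w p < w q := by
  by_contra! hc
  have hlt : w q < w p := lt_of_le_of_ne hc fun e => hpq.ne' (w.injective e)
  have := len_lt_len_mul_tr (hf.mul_tr p q) hpq (by simpa [tr] using hlt)
  rw [mul_assoc, tr_mul_tr, mul_one] at this
  omega

theorem not_between_of_len_mul_tr {p q r : ℕ+} {w : PPerm} (hf : HasFinSupp w)
    (h : len (w * tr p q) = len w + 1) (hpr : p < r) (hrq : r < q) (h1 : w p < w r) :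
    ¬ w r < w q := by
  intro h2
  have hpq := hpr.trans hrq
  have := len_add_ncard_le hf hpq (h1.trans h2) {(p, q), (p, r)} (by
    rintro _ (rfl | rfl)
    · exact ⟨hpq, by simpa [tr] using h1.trans h2⟩
    · exact ⟨hpr, by simpa [tr, Equiv.swap_apply_of_ne_of_ne hpr.ne' hrq.ne] using h2⟩) (by
    rintro ⟨a, b⟩ ⟨hab, hba⟩ h
    simp only [invMap, tr, Equiv.swap_apply_def, Set.mem_singleton_iff,
      Set.mem_insert_iff] at h hab hba
    grind)
  rw [Set.ncard_pair (by simp [hrq.ne'])] at this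
  omega

theorem wSeq_zero (w : PPerm) (d : ℕ) (p q : Fin d → ℕ+) : wSeq w d p q 0 = w := by
  simp [wSeq]

theorem wSeq_succ (w : PPerm) {d : ℕ} (p q : Fin d → ℕ+) (j : Fin d) :
    wSeq w d p q (j + 1) = wSeq w d p q j * tr (p j) (q j) := by
  have hj : (j : ℕ) < (trList d p q).length := by simp [trList]
  rw [wSeq, wSeq, List.prod_take_succ _ _ hj, mul_assoc]
  simp [trList]

theorem hasFinSupp_wSeq {w : PPerm} (hw : HasFinSupp w) {d : ℕ} (p q : Fin d → ℕ+) (j : ℕ)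
    (hj : j ≤ d) : HasFinSupp (wSeq w d p q j) := by
  induction j with
  | zero => rwa [wSeq_zero]
  | succ j ih =>
    rw [wSeq_succ w p q ⟨j, hj⟩]
    exact (ih (by omega)).mul_tr _ _

section Chain

variable {w : PPerm} {i d : ℕ} {p q : Fin d → ℕ+}

theorem wSeq_succ_apply (hpq : ∀ j, (p j : ℕ) ≤ i ∧ i < (q j : ℕ)) {b : ℕ+} (hb : i < (b : ℕ))
    (j : Fin d) : wSeq w d p q (j + 1) b =
      if q j = b then wSeq w d p q j (p j) else wSeq w d p q j b := by
  rw [wSeq_succ, Equiv.Perm.mul_apply, tr]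
  have hp : b ≠ p j := fun e => by
    have := (hpq j).1
    rw [← e] at this
    omega
  split_ifs with h
  · rw [h, Equiv.swap_apply_right]
  · rw [Equiv.swap_apply_of_ne_of_ne hp (Ne.symm h)]

theorem wSeq_apply_le (hpq : ∀ j, (p j : ℕ) ≤ i ∧ i < (q j : ℕ))
    (hlt : ∀ j : Fin d, wSeq w d p q j (p j) < wSeq w d p q j (q j))
    {b : ℕ+} (hb : i < (b : ℕ)) {j k : ℕ} (hjk : j ≤ k) (hk : k ≤ d) :
    wSeq w d p q k b ≤ wSeq w d p q j b := by
  induction k, hjk using Nat.le_induction with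
  | base => exact le_rfl
  | succ k _ ih =>
    refine le_trans ?_ (ih (by omega))
    rw [wSeq_succ_apply hpq hb ⟨k, hk⟩]
    split_ifs with h
    · subst h
      exact (hlt _).le
    · exact le_rfl

/-- The value at a position `b > i` is either untouched or was put there by an earlier step. -/
theorem wSeq_apply_eq_or_last (hpq : ∀ j, (p j : ℕ) ≤ i ∧ i < (q j : ℕ)) {b : ℕ+}
    (hb : i < (b : ℕ)) {j : ℕ} (hj : j ≤ d) : wSeq w d p q j b = w b ∨
      ∃ k : Fin d, (k : ℕ) < j ∧ q k = b ∧ wSeq w d p q j b = wSeq w d p q k (p k) := by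
  induction j with
  | zero => exact Or.inl (by rw [wSeq_zero])
  | succ j ih =>
    rw [wSeq_succ_apply hpq hb ⟨j, hj⟩]
    split_ifs with h
    · exact Or.inr ⟨⟨j, hj⟩, Nat.lt_succ_self j, h, rfl⟩
    · refine (ih (by omega)).imp id ?_
      rintro ⟨k, hk, hkb, e⟩
      exact ⟨k, by omega, hkb, e⟩

/-- The value at a position `b > i` persists until the first later step moving it. -/
theorem wSeq_apply_eq_or_first (hpq : ∀ j, (p j : ℕ) ≤ i ∧ i < (q j : ℕ)) {b : ℕ+}
    (hb : i < (b : ℕ)) {j k : ℕ} (hjk : j ≤ k) (hk : k ≤ d) :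
    wSeq w d p q k b = wSeq w d p q j b ∨
      ∃ l : Fin d, j ≤ (l : ℕ) ∧ q l = b ∧ wSeq w d p q l b = wSeq w d p q j b := by
  induction k, hjk using Nat.le_induction with
  | base => exact Or.inl rfl
  | succ k hjk ih =>
    rcases ih (by omega) with e | e
    · rw [wSeq_succ_apply hpq hb ⟨k, hk⟩]
      split_ifs with h
      · exact Or.inr ⟨⟨k, hk⟩, hjk, h, e⟩
      · exact Or.inl e
    · exact Or.inr e

end Chain

/-- For `w ∈ S^{(n)}` and `ζ = t_{p₁q₁}⋯t_{p_dq_d} ∈ X_{i,d}(w)` or `Y_{i,d}(w)`,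
if `q_j > n` then `m_{p_jq_j}(w_j) = 0`. -/
theorem m_vanishes_beyond_n (n : ℕ) (w : PPerm) (hwf : HasFinSupp w) (hw : InSn n w)
    (i : ℕ) (hi : 1 ≤ i) (hin : i ≤ n) (d : ℕ)
    (p q : Fin d → ℕ+) (h : IsXFact w i d p q ∨ IsYFact w i d p q) :
    ∀ j : Fin d, n < (q j : ℕ) → mCnt (wSeq w d p q j) (p j) (q j) = 0 := by
  intro j hj
  have hpq : ∀ j, (p j : ℕ) ≤ i ∧ i < (q j : ℕ) := h.elim (·.1) (·.1)
  have hlen : ∀ j : Fin d, len (wSeq w d p q j * tr (p j) (q j)) = len (wSeq w d p q j) + 1 :=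
    fun j => by
      rw [← wSeq_succ]
      exact h.elim (·.2.1 j) (·.2.1 j)
  have hfin : ∀ j : Fin d, HasFinSupp (wSeq w d p q j) :=
    fun j => hasFinSupp_wSeq hwf p q j j.2.le
  have hlt : ∀ j : Fin d, wSeq w d p q j (p j) < wSeq w d p q j (q j) := fun j =>
    apply_lt_of_len_mul_tr (hfin j)
      (PNat.coe_lt_coe _ _ |>.1 ((hpq j).1.trans_lt (hpq j).2)) (hlen j)
  suffices {r : ℕ+ | q j < r ∧ wSeq w d p q j (p j) < wSeq w d p q j r ∧
      wSeq w d p q j r < wSeq w d p q j (q j)} = ∅ by rw [mCnt, this, Set.ncard_empty]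
  rw [Set.eq_empty_iff_forall_notMem]
  rintro r ⟨hqr, hr1, hr2⟩
  have hir : i < (r : ℕ) := (hpq j).2.trans (PNat.coe_lt_coe _ _ |>.2 hqr)
  rcases wSeq_apply_eq_or_last hpq hir j.2.le with e | ⟨k, hkj, hk, e⟩
  · have h1 := wSeq_apply_le hpq hlt (hpq j).2 (Nat.zero_le j) j.2.le
    rw [wSeq_zero] at h1
    exact absurd ((e ▸ hr2).trans_le h1) (hw _ _ hj hqr).asymm
  · rcases h with hX | hY
    · exact absurd (e ▸ hr1) (hX.2.2 k j hkj).asymm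
    · have hpk : p k < q j := PNat.coe_lt_coe _ _ |>.1 ((hpq k).1.trans_lt (hpq j).2)
      have hle := wSeq_apply_le hpq hlt (hpq j).2 hkj.le j.2.le
      have hnot := not_between_of_len_mul_tr (hfin k) (hlen k) hpk (hk ▸ hqr)
        ((e ▸ hr2).trans_le hle)
      refine hnot ?_
      rcases wSeq_apply_eq_or_first hpq (hpq j).2 hkj.le j.2.le with e' | ⟨l, hkl, hl, e'⟩
      · exact e' ▸ hY.2.2 k j hkj
      · have hne : k ≠ l := fun c => hqr.ne (by rw [← hl, ← c, hk])
        have := hY.2.2 k l (lt_of_le_of_ne hkl hne)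
        rwa [hl, e'] at this
end
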